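/- arXiv:2003.02161 — 2 statements merged into one kernel-verified Lean document; each statement's English description precedes it below -/
import Mathlib

section
/- Let n ≥ 1, let σ = (S_1,…,S_m) be any sequence of nonempty subsets of {1,…,n}, and let P^t be the probability distribution over permutations maintained by the MWU algorithm at time t. Then for every t, d_tv(P^t, P^{t+1}) ≤ (1/n³) · Σ_π P^t_π · π(S_t); that is, the total variation distance between consecutive MWU distributions is at most 1/n³ times MWU's expected access cost at step t. -/
open Finset

/-- The (1-indexed) access cost of a nonempty set `S` under a permutation `π` of `Fin n`:
the minimum, over elements `e ∈ S`, of the position `(π e) + 1` of `e`. -/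
noncomputable def acc {n : ℕ} (π : Equiv.Perm (Fin n)) (S : Finset (Fin n)) : ℕ :=
  sInf ((fun e => (π e : ℕ) + 1) '' (S : Set (Fin n)))

/-- MWU weights over permutations with update factor `e^{-1/n³}` per unit of access cost:
`w⁰_π = 1` and `w^{t+1}_π = w^t_π · e^{-π(S_t)/n³}`. -/
noncomputable def mwuW {n : ℕ} (S : ℕ → Finset (Fin n)) :
    ℕ → Equiv.Perm (Fin n) → ℝ
  | 0, _ => 1
  | t + 1, π => mwuW S t π * Real.exp (-(acc π (S t) : ℝ) / (n : ℝ) ^ 3)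

/-- The probability distribution over permutations maintained by MWU at time `t`. -/
noncomputable def mwuP {n : ℕ} (S : ℕ → Finset (Fin n)) (t : ℕ)
    (π : Equiv.Perm (Fin n)) : ℝ :=
  mwuW S t π / ∑ ρ : Equiv.Perm (Fin n), mwuW S t ρ

/-- Total variation distance between two distributions over permutations. -/
noncomputable def dTV {n : ℕ} (δ δ' : Equiv.Perm (Fin n) → ℝ) : ℝ :=
  ∑ π : Equiv.Perm (Fin n), max 0 (δ π - δ' π)

/-- The total variation distance between consecutive MWU distributions is at most `1/n³`
times MWU's expected access cost at step `t`. -/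
theorem stmt6 (n : ℕ) (hn : 1 ≤ n) (m : ℕ) (S : ℕ → Finset (Fin n))
    (hS : ∀ t < m, (S t).Nonempty) (t : ℕ) (ht : t < m) :
    dTV (mwuP S t) (mwuP S (t + 1))
      ≤ 1 / (n : ℝ) ^ 3 * ∑ π : Equiv.Perm (Fin n), mwuP S t π * (acc π (S t) : ℝ) := by
  have hpos : ∀ s (π : Equiv.Perm (Fin n)), 0 < mwuW S s π := by
    intro s π
    induction s with
    | zero => simp [mwuW]
    | succ k ih => rw [mwuW]; positivity
  have hsum : ∀ s, 0 < ∑ ρ : Equiv.Perm (Fin n), mwuW S s ρ := fun s =>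
    Finset.sum_pos (fun ρ _ => hpos s ρ) Finset.univ_nonempty
  have hle : ∑ ρ : Equiv.Perm (Fin n), mwuW S (t + 1) ρ
      ≤ ∑ ρ : Equiv.Perm (Fin n), mwuW S t ρ := by
    refine Finset.sum_le_sum fun ρ _ => ?_
    rw [mwuW]
    refine mul_le_of_le_one_right (hpos t ρ).le (Real.exp_le_one_iff.mpr ?_)
    rw [neg_div]
    exact neg_nonpos.mpr (by positivity)
  unfold dTV
  rw [Finset.mul_sum]
  refine Finset.sum_le_sum fun π _ => ?_
  have hP : 0 ≤ mwuP S t π := (div_pos (hpos t π) (hsum t)).le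
  refine max_le (by positivity) ?_
  have h1 : mwuP S t π * Real.exp (-(acc π (S t) : ℝ) / (n : ℝ) ^ 3)
      ≤ mwuP S (t + 1) π := by
    have h2 : mwuW S (t + 1) π / ∑ ρ : Equiv.Perm (Fin n), mwuW S t ρ
        ≤ mwuP S (t + 1) π :=
      div_le_div_of_nonneg_left (hpos (t + 1) π).le (hsum (t + 1)) hle
    refine le_trans (le_of_eq ?_) h2
    rw [mwuP, mwuW]
    ring
  have h3 := mul_le_mul_of_nonneg_left
    (Real.add_one_le_exp (-(acc π (S t) : ℝ) / (n : ℝ) ^ 3)) hP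
  have h4 : mwuP S t π * (-(acc π (S t) : ℝ) / (n : ℝ) ^ 3 + 1)
      = mwuP S t π - 1 / (n : ℝ) ^ 3 * (mwuP S t π * (acc π (S t) : ℝ)) := by ring
  linarith
end

section
/- Let δ be a probability distribution on the set of permutations of {1,…,n}, let r ≥ 1 and 1 ≤ k ≤ n/r, and let S_1,…,S_k be pairwise disjoint subsets of {1,…,n}, each of size r. Set E_j = E_{π∼δ}[π(S_j)] for 1 ≤ j ≤ k. If E_1 ≤ E_2 ≤ … ≤ E_k, then E_j ≥ (j+1)/2 for every 1 ≤ j ≤ k. -/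
open Finset

lemma sum_lower (m : ℕ) : ∀ T : Finset ℕ, T.card = m → (∀ x ∈ T, 1 ≤ x) →
    m * (m + 1) ≤ 2 * ∑ x ∈ T, x := by
  induction m with
  | zero => intro T _ _; simp
  | succ m ih =>
    intro T hT hpos
    have hne : T.Nonempty := by rw [← Finset.card_pos]; omega
    have hmem := T.max'_mem hne
    have hsub : T ⊆ Finset.Icc 1 (T.max' hne) := fun x hx =>
      Finset.mem_Icc.2 ⟨hpos x hx, T.le_max' x hx⟩
    have hc := Finset.card_le_card hsub
    rw [Nat.card_Icc, hT] at hc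
    have h1 := ih (T.erase (T.max' hne)) (by rw [Finset.card_erase_of_mem hmem, hT]; rfl)
      (fun x hx => hpos x (Finset.mem_of_mem_erase hx))
    have h2 := Finset.add_sum_erase T (fun x => x) hmem
    rw [← h2]
    generalize T.max' hne = M at *
    have : m + 1 ≤ M := by omega
    nlinarith

lemma acc_mem {n : ℕ} (π : Equiv.Perm (Fin n)) (S : Finset (Fin n)) (hS : S.Nonempty) :
    ∃ e ∈ S, (π e : ℕ) + 1 = acc π S := by
  have h : ((fun e => (π e : ℕ) + 1) '' (S : Set (Fin n))).Nonempty :=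
    (Finset.coe_nonempty.2 hS).image _
  obtain ⟨e, he, h2⟩ := Nat.sInf_mem h
  exact ⟨e, he, h2⟩

/-- If `S_1, …, S_k` are pairwise disjoint `r`-element sets whose expected access costs
`E_j = E_{π∼δ}[π(S_j)]` under a probability distribution `δ` over permutations satisfy
`E_1 ≤ … ≤ E_k`, then `E_j ≥ (j+1)/2` for every `1 ≤ j ≤ k`. -/
theorem stmt9 (n r k : ℕ) (hr : 1 ≤ r) (hk1 : 1 ≤ k) (hkn : k * r ≤ n)
    (δ : Equiv.Perm (Fin n) → ℝ) (hδ0 : ∀ π, 0 ≤ δ π)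
    (hδ1 : ∑ π : Equiv.Perm (Fin n), δ π = 1)
    (S : ℕ → Finset (Fin n)) (hcard : ∀ j, 1 ≤ j → j ≤ k → (S j).card = r)
    (hdisj : ∀ i j, 1 ≤ i → i < j → j ≤ k → Disjoint (S i) (S j))
    (hmono : ∀ i j, 1 ≤ i → i ≤ j → j ≤ k →
      (∑ π : Equiv.Perm (Fin n), δ π * (acc π (S i) : ℝ))
        ≤ ∑ π : Equiv.Perm (Fin n), δ π * (acc π (S j) : ℝ)) :
    ∀ j, 1 ≤ j → j ≤ k →
      ((j : ℝ) + 1) / 2 ≤ ∑ π : Equiv.Perm (Fin n), δ π * (acc π (S j) : ℝ) := by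
  intro j hj1 hjk
  have hne : ∀ i, 1 ≤ i → i ≤ k → (S i).Nonempty := fun i h1 h2 => by
    rw [← Finset.card_pos, hcard i h1 h2]; omega
  have key : ∀ π : Equiv.Perm (Fin n),
      (j : ℝ) * (j + 1) ≤ 2 * ∑ i ∈ Finset.Icc 1 j, (acc π (S i) : ℝ) := by
    intro π
    have hneq : ∀ a b, 1 ≤ a → a < b → b ≤ k → acc π (S a) ≠ acc π (S b) := by
      intro a b ha hab hb h
      obtain ⟨e, he, h1⟩ := acc_mem π (S a) (hne a ha (by omega))
      obtain ⟨f, hf, h2⟩ := acc_mem π (S b) (hne b (by omega) hb)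
      have hef : e = f := π.injective (Fin.ext (by omega))
      subst hef
      exact Finset.disjoint_left.1 (hdisj a b ha hab hb) he hf
    have hinj : Set.InjOn (fun i => acc π (S i)) (Finset.Icc 1 j : Finset ℕ) := by
      intro a ha b hb h
      rw [Finset.mem_coe, Finset.mem_Icc] at ha hb
      rcases lt_trichotomy a b with hab | hab | hab
      · exact absurd h (hneq a b ha.1 hab (by omega))
      · exact hab
      · exact absurd h.symm (hneq b a hb.1 hab (by omega))
    have h := sum_lower j ((Finset.Icc 1 j).image (fun i => acc π (S i)))
      (by rw [Finset.card_image_of_injOn hinj]; simp)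
      (by
        intro x hx
        obtain ⟨i, hi, rfl⟩ := Finset.mem_image.1 hx
        rw [Finset.mem_Icc] at hi
        obtain ⟨e, _, h1⟩ := acc_mem π (S i) (hne i hi.1 (by omega))
        omega)
    rw [Finset.sum_image hinj] at h
    exact_mod_cast h
  have hle : ∑ i ∈ Finset.Icc 1 j, ∑ π : Equiv.Perm (Fin n), δ π * (acc π (S i) : ℝ)
      ≤ j * ∑ π : Equiv.Perm (Fin n), δ π * (acc π (S j) : ℝ) := by
    have := Finset.sum_le_card_nsmul (Finset.Icc 1 j)
      (fun i => ∑ π : Equiv.Perm (Fin n), δ π * (acc π (S i) : ℝ)) _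
      (fun i hi => hmono i j (Finset.mem_Icc.1 hi).1 (Finset.mem_Icc.1 hi).2 hjk)
    simpa using this
  have hge : (j : ℝ) * (j + 1) ≤
      2 * ∑ i ∈ Finset.Icc 1 j, ∑ π : Equiv.Perm (Fin n), δ π * (acc π (S i) : ℝ) := by
    rw [Finset.sum_comm]
    calc (j : ℝ) * (j + 1) = ∑ π : Equiv.Perm (Fin n), δ π * ((j : ℝ) * (j + 1)) := by
          rw [← Finset.sum_mul, hδ1, one_mul]
      _ ≤ ∑ π : Equiv.Perm (Fin n), δ π * (2 * ∑ i ∈ Finset.Icc 1 j, (acc π (S i) : ℝ)) :=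
          Finset.sum_le_sum fun π _ => mul_le_mul_of_nonneg_left (key π) (hδ0 π)
      _ = _ := by
          rw [Finset.mul_sum]
          refine Finset.sum_congr rfl fun π _ => ?_
          rw [← Finset.mul_sum]; ring
  have hjpos : (0 : ℝ) < j := by exact_mod_cast hj1
  have : (j : ℝ) * (j + 1) ≤ j * (2 * ∑ π : Equiv.Perm (Fin n), δ π * (acc π (S j) : ℝ)) := by
    linarith
  have := le_of_mul_le_mul_left this hjpos
  linarith
end
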